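/- There exist constants δ₁ > 0 and C > 0 such that every Q ∈ Sym₀ with dist(Q, N) ≤ δ₁ satisfies: Q ∉ 𝒞 (so that the nearest-point projection R(Q) = s*(n⊗n − (1/3)Id) onto N, with n a unit eigenvector for the largest eigenvalue of Q, is well defined) and |g(Q) − g(R(Q))| ≤ C · dist(Q, N). -/

import Mathlib

open Matrix

noncomputable section

/-- The space `Sym₀` of symmetric traceless `3 × 3` real matrices (as a subset of matrices). -/
def Sym0 : Set (Matrix (Fin 3) (Fin 3) ℝ) := {Q | Q.IsSymm ∧ Q.trace = 0}

/-- The norm `|Q| = √(tr Q²)`. -/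
def nrm (Q : Matrix (Fin 3) (Fin 3) ℝ) : ℝ := Real.sqrt ((Q * Q).trace)

/-- The Landau-de Gennes bulk potential
`f(Q) = C - a/2 tr(Q²) - b/3 tr(Q³) + c/4 (tr(Q²))²`. -/
def fLdG (a b c C : ℝ) (Q : Matrix (Fin 3) (Fin 3) ℝ) : ℝ :=
  C - a / 2 * (Q * Q).trace - b / 3 * (Q * Q * Q).trace + c / 4 * ((Q * Q).trace) ^ 2

/-- `s* = (b + √(b² + 24 a c))/(4c)`. -/
def sstar (a b c : ℝ) : ℝ := (b + Real.sqrt (b ^ 2 + 24 * a * c)) / (4 * c)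

/-- The matrix `n ⊗ n` with entries `nᵢ nⱼ`. -/
def outer (n : Fin 3 → ℝ) : Matrix (Fin 3) (Fin 3) ℝ := Matrix.of fun i j => n i * n j

/-- `n` is a unit vector of `ℝ³`. -/
def unitVec (n : Fin 3 → ℝ) : Prop := n 0 ^ 2 + n 1 ^ 2 + n 2 ^ 2 = 1

/-- The uniaxial matrix `s (n ⊗ n - Id/3)`. -/
def uniax (s : ℝ) (n : Fin 3 → ℝ) : Matrix (Fin 3) (Fin 3) ℝ :=
  s • (outer n - (1 / 3 : ℝ) • (1 : Matrix (Fin 3) (Fin 3) ℝ))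

/-- The vacuum manifold `N = { s* (n ⊗ n - Id/3) : n ∈ S² }`. -/
def Nset (a b c : ℝ) : Set (Matrix (Fin 3) (Fin 3) ℝ) :=
  {Q | ∃ n : Fin 3 → ℝ, unitVec n ∧ Q = uniax (sstar a b c) n}

/-- The distance `dist(Q, N) = inf_{P ∈ N} |Q - P|` measured in the norm `|·| = √(tr(·²))`. -/
def distN (a b c : ℝ) (Q : Matrix (Fin 3) (Fin 3) ℝ) : ℝ :=
  sInf ((fun P => nrm (Q - P)) '' Nset a b c)

/-- The magnetic potential `g(Q) = √(2/3) - Q₃₃/|Q|` (with `g(0) = 0`). -/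
def gfun (Q : Matrix (Fin 3) (Fin 3) ℝ) : ℝ :=
  if Q = 0 then 0 else Real.sqrt (2 / 3) - Q 2 2 / nrm Q

/-- The largest eigenvalue `λ₁(Q)` of a symmetric matrix `Q`, characterized as the maximum of the
quadratic form `v ↦ vᵀ Q v` over unit vectors `v`. -/
def lam1 (Q : Matrix (Fin 3) (Fin 3) ℝ) : ℝ :=
  sSup {x : ℝ | ∃ v : Fin 3 → ℝ, v ⬝ᵥ v = 1 ∧ x = v ⬝ᵥ Q.mulVec v}

/-- The smallest eigenvalue `λ₃(Q)` of a symmetric matrix `Q`, characterized as the minimum of the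
quadratic form `v ↦ vᵀ Q v` over unit vectors `v`. -/
def lam3 (Q : Matrix (Fin 3) (Fin 3) ℝ) : ℝ :=
  sInf {x : ℝ | ∃ v : Fin 3 → ℝ, v ⬝ᵥ v = 1 ∧ x = v ⬝ᵥ Q.mulVec v}

/-- The middle eigenvalue `λ₂(Q) = tr Q - λ₁(Q) - λ₃(Q)` of a symmetric matrix `Q`. -/
def lam2 (Q : Matrix (Fin 3) (Fin 3) ℝ) : ℝ := Q.trace - lam1 Q - lam3 Q

lemma trace_mul_self_eq_sum {Q : Matrix (Fin 3) (Fin 3) ℝ} (hQ : Q.IsSymm) :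
    (Q * Q).trace = ∑ i, ∑ j, Q i j ^ 2 := by
  simp only [Matrix.trace, Matrix.diag_apply, Matrix.mul_apply]
  refine Finset.sum_congr rfl fun i _ => Finset.sum_congr rfl fun j _ => ?_
  rw [hQ.apply i j, sq]

lemma nrm_sq {Q : Matrix (Fin 3) (Fin 3) ℝ} (hQ : Q.IsSymm) : nrm Q ^ 2 = (Q * Q).trace := by
  refine Real.sq_sqrt ?_
  rw [trace_mul_self_eq_sum hQ]
  positivity

lemma nrm_nonneg (Q : Matrix (Fin 3) (Fin 3) ℝ) : 0 ≤ nrm Q := Real.sqrt_nonneg _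

attribute [local instance] Matrix.frobeniusNormedAddCommGroup in
lemma nrm_eq_frobenius_norm {Q : Matrix (Fin 3) (Fin 3) ℝ} (hQ : Q.IsSymm) : nrm Q = ‖Q‖ := by
  rw [nrm, Matrix.frobenius_norm_def, trace_mul_self_eq_sum hQ, Real.sqrt_eq_rpow]
  simp

attribute [local instance] Matrix.frobeniusNormedAddCommGroup in
lemma abs_nrm_sub_nrm_le {Q R : Matrix (Fin 3) (Fin 3) ℝ} (hQ : Q.IsSymm) (hR : R.IsSymm) :
    |nrm Q - nrm R| ≤ nrm (Q - R) := by
  rw [nrm_eq_frobenius_norm hQ, nrm_eq_frobenius_norm hR, nrm_eq_frobenius_norm (hQ.sub hR)]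
  exact abs_norm_sub_norm_le Q R

attribute [local instance] Matrix.frobeniusNormedAddCommGroup in
lemma nrm_pos {Q : Matrix (Fin 3) (Fin 3) ℝ} (hQ : Q.IsSymm) (h0 : Q ≠ 0) : 0 < nrm Q := by
  rw [nrm_eq_frobenius_norm hQ]
  exact norm_pos_iff.mpr h0

/-- Cauchy-Schwarz for the quadratic form of a symmetric matrix. -/
lemma abs_dotProduct_mulVec_le {Q : Matrix (Fin 3) (Fin 3) ℝ} (hQ : Q.IsSymm)
    {v : Fin 3 → ℝ} (hv : v ⬝ᵥ v = 1) : |v ⬝ᵥ Q.mulVec v| ≤ nrm Q := by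
  refine Real.abs_le_sqrt ?_
  have h := Finset.sum_mul_sq_le_sq_mul_sq (Finset.univ : Finset (Fin 3 × Fin 3))
    (fun p => Q p.1 p.2) (fun p => v p.1 * v p.2)
  have h1 : ∑ p : Fin 3 × Fin 3, Q p.1 p.2 * (v p.1 * v p.2) = v ⬝ᵥ Q.mulVec v := by
    simp only [Fintype.sum_prod_type, dotProduct, Matrix.mulVec, Finset.mul_sum]
    exact Finset.sum_congr rfl fun i _ => Finset.sum_congr rfl fun j _ => by ring
  have h2 : ∑ p : Fin 3 × Fin 3, (v p.1 * v p.2) ^ 2 = 1 := by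
    have : ∑ p : Fin 3 × Fin 3, (v p.1 * v p.2) ^ 2 = (v ⬝ᵥ v) * (v ⬝ᵥ v) := by
      simp only [Fintype.sum_prod_type, dotProduct, Finset.sum_mul_sum]
      exact Finset.sum_congr rfl fun i _ => Finset.sum_congr rfl fun j _ => by ring
    rw [this, hv, one_mul]
  rwa [h1, h2, mul_one, Fintype.sum_prod_type, ← trace_mul_self_eq_sum hQ] at h

lemma abs_apply_two_two_le_nrm {Q : Matrix (Fin 3) (Fin 3) ℝ} (hQ : Q.IsSymm) :
    |Q 2 2| ≤ nrm Q := by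
  simpa [dotProduct, Matrix.mulVec, Fin.sum_univ_three] using
    abs_dotProduct_mulVec_le hQ (v := ![0, 0, 1]) (by simp [dotProduct, Fin.sum_univ_three])

lemma dotProduct_mulVec_le_lam1 {Q : Matrix (Fin 3) (Fin 3) ℝ} (hQ : Q.IsSymm)
    {v : Fin 3 → ℝ} (hv : v ⬝ᵥ v = 1) : v ⬝ᵥ Q.mulVec v ≤ lam1 Q := by
  refine le_csSup ⟨nrm Q, ?_⟩ ⟨v, hv, rfl⟩
  rintro _ ⟨w, hw, rfl⟩
  exact (abs_le.mp (abs_dotProduct_mulVec_le hQ hw)).2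

lemma unitVec_iff (n : Fin 3 → ℝ) : unitVec n ↔ n ⬝ᵥ n = 1 := by
  simp [unitVec, dotProduct, Fin.sum_univ_three, sq]

lemma uniax_isSymm (s : ℝ) (n : Fin 3 → ℝ) : (uniax s n).IsSymm := by
  ext i j
  simp [uniax, outer, Matrix.one_apply, eq_comm, mul_comm]

lemma dotProduct_uniax_mulVec (s : ℝ) {n v : Fin 3 → ℝ} (hv : v ⬝ᵥ v = 1) :
    v ⬝ᵥ (uniax s n).mulVec v = s * ((n ⬝ᵥ v) ^ 2 - 1 / 3) := by
  simp only [uniax, outer, dotProduct, Matrix.mulVec, Fin.sum_univ_three, Matrix.smul_apply,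
    Matrix.sub_apply, Matrix.of_apply, Matrix.one_apply, smul_eq_mul] at hv ⊢
  simp
  linear_combination (-s / 3) * hv

lemma nrm_sub_uniax_sq {Q : Matrix (Fin 3) (Fin 3) ℝ} (hQ : Q ∈ Sym0) (s : ℝ)
    {n : Fin 3 → ℝ} (hn : n ⬝ᵥ n = 1) :
    nrm (Q - uniax s n) ^ 2 = nrm Q ^ 2 - 2 * s * (n ⬝ᵥ Q.mulVec n) + 2 / 3 * s ^ 2 := by
  obtain ⟨hS, ht⟩ := hQ
  have h01 := hS.apply 0 1
  have h02 := hS.apply 0 2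
  have h12 := hS.apply 1 2
  rw [nrm_sq hS, nrm_sq (hS.sub (uniax_isSymm s n)), trace_mul_self_eq_sum hS,
    trace_mul_self_eq_sum (hS.sub (uniax_isSymm s n))]
  simp only [uniax, outer, dotProduct, Matrix.mulVec, Fin.sum_univ_three, Matrix.smul_apply,
    Matrix.sub_apply, Matrix.of_apply, Matrix.one_apply, smul_eq_mul, Matrix.trace,
    Matrix.diag_apply] at hn ht ⊢
  simp
  linear_combination (2 * s / 3) * ht +
    (s ^ 2 * (n 0 * n 0 + n 1 * n 1 + n 2 * n 2 + 1) - 2 / 3 * s ^ 2) * hn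

lemma nrm_uniax {s : ℝ} (hs : 0 ≤ s) {n : Fin 3 → ℝ} (hn : n ⬝ᵥ n = 1) :
    nrm (uniax s n) = Real.sqrt (2 / 3) * s := by
  have h := nrm_sub_uniax_sq (Q := 0) ⟨Matrix.isSymm_zero, Matrix.trace_zero _ _⟩ s hn
  rw [zero_sub] at h
  have h1 : nrm (-uniax s n) = nrm (uniax s n) := by simp [nrm]
  have h2 : nrm (0 : Matrix (Fin 3) (Fin 3) ℝ) = 0 := by simp [nrm]
  rw [h1, h2] at h
  simp only [Matrix.zero_mulVec, dotProduct_zero] at h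
  rw [← Real.sqrt_sq (nrm_nonneg (uniax s n)), h]
  rw [show (0 : ℝ) ^ 2 - 2 * s * 0 + 2 / 3 * s ^ 2 = 2 / 3 * s ^ 2 by ring,
    Real.sqrt_mul (by norm_num), Real.sqrt_sq hs]

/-- For a top eigenvector `n`, the uniaxial matrix `uniax s n` is closest to `Q`. -/
lemma nrm_sub_uniax_le {Q : Matrix (Fin 3) (Fin 3) ℝ} (hQ : Q ∈ Sym0) {s : ℝ} (hs : 0 ≤ s)
    {n m : Fin 3 → ℝ} (hn : n ⬝ᵥ n = 1) (hm : m ⬝ᵥ m = 1) (hnQ : Q.mulVec n = lam1 Q • n) :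
    nrm (Q - uniax s n) ≤ nrm (Q - uniax s m) := by
  have hnl : n ⬝ᵥ Q.mulVec n = lam1 Q := by
    rw [hnQ, dotProduct_smul, hn, smul_eq_mul, mul_one]
  refine le_of_sq_le_sq ?_ (nrm_nonneg _)
  rw [nrm_sub_uniax_sq hQ s hn, nrm_sub_uniax_sq hQ s hm, hnl]
  have := mul_le_mul_of_nonneg_left (dotProduct_mulVec_le_lam1 hQ.1 hm) hs
  linarith

lemma abs_gfun_sub_le {Q R : Matrix (Fin 3) (Fin 3) ℝ} (hQ : Q.IsSymm) (hR : R.IsSymm)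
    (hQ0 : Q ≠ 0) (hR0 : R ≠ 0) : |gfun Q - gfun R| ≤ 2 / nrm R * nrm (Q - R) := by
  have hq := nrm_pos hQ hQ0
  have hr := nrm_pos hR hR0
  have h1 : |Q 2 2 - R 2 2| ≤ nrm (Q - R) := abs_apply_two_two_le_nrm (hQ.sub hR)
  have h2 := abs_nrm_sub_nrm_le hQ hR
  have h3 : |Q 2 2| / nrm Q ≤ 1 := (div_le_one hq).mpr (abs_apply_two_two_le_nrm hQ)
  have key : gfun Q - gfun R =
      (Q 2 2 / nrm Q * (nrm Q - nrm R) - (Q 2 2 - R 2 2)) / nrm R := by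
    simp only [gfun, hQ0, hR0, if_false]
    field_simp
    ring
  rw [key, abs_div, abs_of_pos hr, div_mul_eq_mul_div (2 : ℝ)]
  gcongr
  calc |Q 2 2 / nrm Q * (nrm Q - nrm R) - (Q 2 2 - R 2 2)|
      ≤ |Q 2 2 / nrm Q * (nrm Q - nrm R)| + |Q 2 2 - R 2 2| := abs_sub _ _
    _ = |Q 2 2| / nrm Q * |nrm Q - nrm R| + |Q 2 2 - R 2 2| := by
        rw [abs_mul, abs_div, abs_of_pos hq]
    _ ≤ 1 * nrm (Q - R) + nrm (Q - R) := by gcongr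
    _ = 2 * nrm (Q - R) := by ring

lemma le_lam1_of_nrm_sub_uniax {Q : Matrix (Fin 3) (Fin 3) ℝ} (hQ : Q.IsSymm) (s : ℝ)
    {m : Fin 3 → ℝ} (hm : m ⬝ᵥ m = 1) : 2 / 3 * s - nrm (Q - uniax s m) ≤ lam1 Q := by
  have h1 := dotProduct_mulVec_le_lam1 hQ hm
  have h2 := abs_le.mp (abs_dotProduct_mulVec_le (hQ.sub (uniax_isSymm s m)) hm)
  rw [Matrix.sub_mulVec, dotProduct_sub, dotProduct_uniax_mulVec s hm, hm] at h2
  linarith [h2.1]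

lemma le_lam3_of_nrm_sub_uniax {Q : Matrix (Fin 3) (Fin 3) ℝ} (hQ : Q.IsSymm) {s : ℝ}
    (hs : 0 ≤ s) {m : Fin 3 → ℝ} : -(s / 3) - nrm (Q - uniax s m) ≤ lam3 Q := by
  refine le_csInf ⟨_, ![0, 0, 1], by simp [dotProduct, Fin.sum_univ_three], rfl⟩ ?_
  rintro _ ⟨v, hv, rfl⟩
  have h2 := abs_le.mp (abs_dotProduct_mulVec_le (hQ.sub (uniax_isSymm s m)) hv)
  rw [Matrix.sub_mulVec, dotProduct_sub, dotProduct_uniax_mulVec s hv] at h2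
  have := mul_nonneg hs (sq_nonneg (m ⬝ᵥ v))
  linarith [h2.1]

lemma Nset_nonempty (a b c : ℝ) : (Nset a b c).Nonempty :=
  ⟨_, ![0, 0, 1], by simp [unitVec], rfl⟩

lemma sstar_pos {a b c : ℝ} (hb : 0 < b) (hc : 0 < c) : 0 < sstar a b c :=
  div_pos (add_pos_of_pos_of_nonneg hb (Real.sqrt_nonneg _)) (by positivity)

/-- There are `δ₁, C > 0` such that every `Q ∈ Sym₀` with `dist(Q, N) ≤ δ₁` lies outside the
biaxial cone (`λ₁(Q) ≠ λ₂(Q)`), so that the nearest-point projection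
`R(Q) = s*(n⊗n - Id/3)` (with `n` a unit eigenvector for `λ₁(Q)`) is well defined, and
`|g(Q) - g(R(Q))| ≤ C dist(Q, N)`. -/
theorem statement9 (a b c : ℝ) (ha : 0 < a) (hb : 0 < b) (hc : 0 < c) :
    ∃ δ₁ > (0 : ℝ), ∃ C > (0 : ℝ), ∀ Q ∈ Sym0, distN a b c Q ≤ δ₁ →
      lam1 Q ≠ lam2 Q ∧
      ∀ n : Fin 3 → ℝ, n ⬝ᵥ n = 1 → Q.mulVec n = lam1 Q • n →
        |gfun Q - gfun (uniax (sstar a b c) n)| ≤ C * distN a b c Q := by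
  have hs : 0 < sstar a b c := sstar_pos hb hc
  have hs23 : 0 < Real.sqrt (2 / 3) * sstar a b c := by positivity
  refine ⟨sstar a b c / 6, by positivity, 2 / (Real.sqrt (2 / 3) * sstar a b c), by positivity,
    fun Q hQ hd => ?_⟩
  have hne := (Nset_nonempty a b c).image fun P => nrm (Q - P)
  obtain ⟨_, ⟨_, ⟨m, hm, rfl⟩, rfl⟩, hr⟩ :=
    exists_lt_of_csInf_lt hne (show distN a b c Q < sstar a b c / 3 by linarith)
  rw [unitVec_iff] at hm
  have h1 := le_lam1_of_nrm_sub_uniax hQ.1 (sstar a b c) hm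
  refine ⟨fun h => ?_, fun n hn hnQ => ?_⟩
  · have h3 := le_lam3_of_nrm_sub_uniax hQ.1 hs.le (m := m)
    rw [lam2, hQ.2] at h
    linarith
  · have hQ0 : Q ≠ 0 := by
      rintro rfl
      have h0 : n ⬝ᵥ lam1 0 • n = 0 := by rw [← hnQ, Matrix.zero_mulVec, dotProduct_zero]
      rw [dotProduct_smul, hn, smul_eq_mul, mul_one] at h0
      linarith
    have hR := nrm_uniax hs.le hn
    have hR0 : uniax (sstar a b c) n ≠ 0 := by
      intro h
      rw [h] at hR
      simp [nrm] at hR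
      linarith
    have hg := abs_gfun_sub_le hQ.1 (uniax_isSymm _ n) hQ0 hR0
    rw [hR] at hg
    refine hg.trans (mul_le_mul_of_nonneg_left (le_csInf hne ?_) (by positivity))
    rintro _ ⟨_, ⟨p, hp, rfl⟩, rfl⟩
    exact nrm_sub_uniax_le hQ hs.le hn ((unitVec_iff p).mp hp) hnQ

end
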